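/- Let X be a type with a total cyclic order, x₀ ∈ X, g ≥ 1, and let A₁, B₁, …, A_g, B_g be order-preserving bijections of X satisfying the surface relation. Then for any choice of lifts Ã₁, B̃₁, …, Ã_g, B̃_g of A₁, B₁, …, A_g, B_g, the product (Ã₁∘B̃₁∘Ã₁⁻¹∘B̃₁⁻¹)∘⋯∘(Ã_g∘B̃_g∘Ã_g⁻¹∘B̃_g⁻¹) equals hᵉ for a unique integer e; moreover e depends neither on the choice of the lifts nor on the choice of the base point x₀. (Well-definedness of the Euler number via Milnor's algorithm, Section 2.3.4 of the paper.) -/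

import Mathlib

/-- The relation `x ≺ y` on `X` relative to a base point `x₀`:
`x ≺ y` iff (`x = x₀` and `y ≠ x₀`) or `sbtw x₀ x y`. -/
def Prec {X : Type*} [CircularOrder X] (x₀ x y : X) : Prop :=
  (x = x₀ ∧ y ≠ x₀) ∨ sbtw x₀ x y

/-- The strict order `<ₓ₀` on `ℤ × X`. -/
def LtZX {X : Type*} [CircularOrder X] (x₀ : X) (a b : ℤ × X) : Prop :=
  a.1 < b.1 ∨ (a.1 = b.1 ∧ Prec x₀ a.2 b.2)

/-- An order-preserving bijection (permutation) of a cyclically ordered set. -/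
def OrderPreservingPerm {X : Type*} [CircularOrder X] (f : Equiv.Perm X) : Prop :=
  ∀ a b c : X, sbtw a b c → sbtw (f a) (f b) (f c)

/-- A lift of an order-preserving bijection `f` of `X`: a bijection of `ℤ × X` that
projects to `f` and is increasing for `<ₓ₀`. -/
def IsLiftPerm {X : Type*} [CircularOrder X] (x₀ : X) (f : Equiv.Perm X)
    (F : Equiv.Perm (ℤ × X)) : Prop :=
  (∀ p : ℤ × X, (F p).2 = f p.2) ∧
  ∀ a b : ℤ × X, LtZX x₀ a b → LtZX x₀ (F a) (F b)

/-- The shift `h : (n, x) ↦ (n + 1, x)` of `ℤ × X`, as a permutation. -/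
def shiftPerm (X : Type*) : Equiv.Perm (ℤ × X) :=
  Equiv.prodCongr (Equiv.addRight (1 : ℤ)) (Equiv.refl X)

theorem sbtw_or_sbtw_of_ne {X : Type*} [CircularOrder X] {a b c : X}
    (hab : a ≠ b) (hbc : b ≠ c) (hca : c ≠ a) : sbtw a b c ∨ sbtw c b a := by
  by_contra! h
  have h₁ := btw_iff_not_sbtw.2 h.1
  have h₂ := btw_iff_not_sbtw.2 h.2
  rcases h₂.antisymm h₁ with h | h | h
  exacts [hab h, hbc h, hca h]

namespace Prec

variable {X : Type*} [CircularOrder X] {x₀ x y z : X}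

theorem irrefl (x₀ x : X) : ¬Prec x₀ x x := by
  rintro (⟨h, h'⟩ | h)
  exacts [h' h, sbtw_irrefl_right h]

theorem trans (hxy : Prec x₀ x y) (hyz : Prec x₀ y z) : Prec x₀ x z := by
  rcases hxy with ⟨rfl, hy⟩ | hxy <;> rcases hyz with ⟨rfl, hz⟩ | hyz
  · exact absurd rfl hy
  · exact Or.inl ⟨rfl, fun h => sbtw_irrefl_left_right (h ▸ hyz)⟩
  · exact absurd hxy sbtw_irrefl_left_right
  · exact Or.inr (hxy.trans_right hyz)

theorem asymm (hxy : Prec x₀ x y) : ¬Prec x₀ y x :=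
  fun hyx => irrefl _ _ (hxy.trans hyx)

theorem trichotomous (x₀ x y : X) : Prec x₀ x y ∨ x = y ∨ Prec x₀ y x := by
  by_cases hxy : x = y
  · exact Or.inr (Or.inl hxy)
  by_cases hx : x = x₀
  · exact Or.inl (Or.inl ⟨hx, fun hy => hxy (hx.trans hy.symm)⟩)
  by_cases hy : y = x₀
  · exact Or.inr (Or.inr (Or.inl ⟨hy, hx⟩))
  rcases sbtw_or_sbtw_of_ne (Ne.symm hx) hxy hy with h | h
  · exact Or.inl (Or.inr h)
  · exact Or.inr (Or.inr (Or.inr h.cyclic_right))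

theorem map {f : Equiv.Perm X} (hf : OrderPreservingPerm f) (h : Prec x₀ x y) :
    Prec (f x₀) (f x) (f y) := by
  rcases h with ⟨rfl, hy⟩ | h
  · exact Or.inl ⟨rfl, fun h => hy (f.injective h)⟩
  · exact Or.inr (hf _ _ _ h)

/-- Two points on the same side of `y₀` are ordered alike from `x₀` and from `y₀`. -/
theorem rebase {y₀ : X} (h : Prec x₀ x y) (hs : Prec x₀ x y₀ ↔ Prec x₀ y y₀) :
    Prec y₀ x y := by
  by_cases hy : Prec x₀ y y₀
  · rcases hy with ⟨rfl, -⟩ | hy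
    · rcases h with ⟨rfl, h⟩ | h
      exacts [absurd rfl h, absurd h sbtw_irrefl_left_right]
    · rcases h with ⟨rfl, -⟩ | h
      · exact Or.inr hy.cyclic_right
      · exact Or.inr (hy.cyclic_right.trans_left h)
  · rcases trichotomous x₀ x y₀ with hx | rfl | hx
    · exact absurd (hs.1 hx) hy
    · exact Or.inl ⟨rfl, fun e => irrefl _ _ (e ▸ h)⟩
    · rcases h with ⟨rfl, -⟩ | h
      · rcases hx with ⟨rfl, hx⟩ | hx
        exacts [absurd rfl hx, absurd hx sbtw_irrefl_left_right]
      · rcases hx with ⟨rfl, -⟩ | hx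
        · exact Or.inr h
        · exact Or.inr (h.cyclic_right.trans_left hx).cyclic_left

/-- Points on or after `y₀` precede, seen from `y₀`, the points before `y₀`. -/
theorem rebase_of_not {y₀ : X} (hx : ¬Prec x₀ x y₀) (hy : Prec x₀ y y₀) : Prec y₀ x y := by
  rcases trichotomous x₀ x y₀ with h | rfl | h
  · exact absurd h hx
  · exact Or.inl ⟨rfl, fun e => irrefl _ _ (e ▸ hy)⟩
  · rcases hy with ⟨rfl, hy⟩ | hy
    · rcases h with ⟨rfl, -⟩ | h
      exacts [absurd rfl hy, Or.inr h.cyclic_left]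
    · rcases h with ⟨rfl, -⟩ | h
      · exact absurd hy sbtw_irrefl_left_right
      · exact Or.inr (h.cyclic_left.trans_right hy.cyclic_right)

end Prec

namespace LtZX

variable {X : Type*} [CircularOrder X] {x₀ : X} {a b : ℤ × X}

theorem asymm (hab : LtZX x₀ a b) : ¬LtZX x₀ b a := by
  rintro (h | ⟨h, h'⟩) <;> rcases hab with h₁ | ⟨h₁, h₂⟩
  · omega
  · omega
  · omega
  · exact h'.asymm h₂

theorem trichotomous (x₀ : X) (a b : ℤ × X) : LtZX x₀ a b ∨ a = b ∨ LtZX x₀ b a := by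
  rcases lt_trichotomy a.1 b.1 with h | h | h
  · exact Or.inl (Or.inl h)
  · rcases Prec.trichotomous x₀ a.2 b.2 with h' | h' | h'
    · exact Or.inl (Or.inr ⟨h, h'⟩)
    · exact Or.inr (Or.inl (Prod.ext h h'))
    · exact Or.inr (Or.inr (Or.inr ⟨h.symm, h'⟩))
  · exact Or.inr (Or.inr (Or.inl h))

theorem fst_lt (h : LtZX x₀ a b) (hab : a.2 = b.2) : a.1 < b.1 := by
  rcases h with h | ⟨-, h⟩
  · exact h
  · exact absurd (hab ▸ h) (Prec.irrefl _ _)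

theorem fst_le (h : LtZX x₀ a b) : a.1 ≤ b.1 := by
  rcases h with h | ⟨h, -⟩
  exacts [h.le, h.le]

/-- An increasing bijection between two of the orders on `ℤ × X` reflects the order. -/
theorem of_map {y₀ : X} {F : Equiv.Perm (ℤ × X)}
    (hF : ∀ a b, LtZX x₀ a b → LtZX y₀ (F a) (F b)) (h : LtZX y₀ (F a) (F b)) :
    LtZX x₀ a b := by
  rcases trichotomous x₀ a b with h' | rfl | h'
  · exact h'
  · exact absurd h h.asymm
  · exact absurd (hF _ _ h') h.asymm

end LtZX

section Shift

variable {X : Type*}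

theorem shiftPerm_zpow_apply (k : ℤ) (p : ℤ × X) : (shiftPerm X ^ k) p = (p.1 + k, p.2) := by
  induction k with
  | zero => simp
  | succ n ih =>
    rw [add_comm, zpow_add, Equiv.Perm.mul_apply, ih]
    simp [shiftPerm]; ring
  | pred n ih =>
    rw [sub_eq_neg_add, zpow_add, Equiv.Perm.mul_apply, ih, zpow_neg_one, Equiv.Perm.inv_eq_iff_eq]
    simp [shiftPerm]; ring

end Shift

section Rebase

variable {X : Type*} [CircularOrder X]

open Classical in
/-- The change of base point: the bijection of `ℤ × X` over the identity of `X` that carries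
the order based at `x₀` to the order based at `y₀`. -/
noncomputable def rebasePerm (x₀ y₀ : X) : Equiv.Perm (ℤ × X) where
  toFun p := (p.1 - if Prec x₀ p.2 y₀ then 1 else 0, p.2)
  invFun p := (p.1 + if Prec x₀ p.2 y₀ then 1 else 0, p.2)
  left_inv p := by simp
  right_inv p := by simp

theorem rebasePerm_lt (x₀ y₀ : X) (a b : ℤ × X) (h : LtZX x₀ a b) :
    LtZX y₀ (rebasePerm x₀ y₀ a) (rebasePerm x₀ y₀ b) := by
  simp only [rebasePerm, LtZX, Equiv.coe_fn_mk]
  by_cases ha : Prec x₀ a.2 y₀ <;> by_cases hb : Prec x₀ b.2 y₀ <;>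
    simp only [ha, hb, if_true, if_false] <;> rcases h with h | ⟨h, h'⟩
  · left; omega
  · exact Or.inr ⟨by omega, h'.rebase (iff_of_true ha hb)⟩
  · left; omega
  · left; omega
  · by_cases e : a.1 - 0 < b.1 - 1
    · exact Or.inl e
    · exact Or.inr ⟨by omega, Prec.rebase_of_not ha hb⟩
  · exact absurd (h'.trans hb) ha
  · left; omega
  · exact Or.inr ⟨by omega, h'.rebase (iff_of_false ha hb)⟩

theorem rebasePerm_commute_shiftPerm (x₀ y₀ : X) :
    Commute (rebasePerm x₀ y₀) (shiftPerm X) := by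
  ext p <;> simp [rebasePerm, shiftPerm]
  ring

end Rebase

namespace IsLiftPerm

variable {X : Type*} [CircularOrder X] {x₀ y₀ : X} {f f' : Equiv.Perm X}
  {F F' : Equiv.Perm (ℤ × X)}

theorem one (x₀ : X) : IsLiftPerm x₀ 1 1 := ⟨fun _ => rfl, fun _ _ h => h⟩

theorem mul (hF : IsLiftPerm x₀ f F) (hF' : IsLiftPerm x₀ f' F') :
    IsLiftPerm x₀ (f * f') (F * F') :=
  ⟨fun p => by simp [hF.1, hF'.1], fun _ _ h => hF.2 _ _ (hF'.2 _ _ h)⟩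

theorem inv (hF : IsLiftPerm x₀ f F) : IsLiftPerm x₀ f⁻¹ F⁻¹ := by
  refine ⟨fun p => ?_, fun a b h => LtZX.of_map hF.2 (by simpa using h)⟩
  rw [Equiv.Perm.eq_inv_iff_eq, ← hF.1]
  simp

theorem list_prod {n : ℕ} {f : Fin n → Equiv.Perm X} {F : Fin n → Equiv.Perm (ℤ × X)}
    (h : ∀ i, IsLiftPerm x₀ (f i) (F i)) :
    IsLiftPerm x₀ (List.ofFn f).prod (List.ofFn F).prod := by
  induction n with
  | zero => simpa using one x₀
  | succ n ih =>
    simp only [List.ofFn_succ, List.prod_cons]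
    exact (h 0).mul (ih fun i => h i.succ)

theorem fst_add_one_le (hF : IsLiftPerm x₀ f F) (p : ℤ × X) :
    (F p).1 + 1 ≤ (F (shiftPerm X p)).1 :=
  (hF.2 p (shiftPerm X p) (Or.inl (by simp [shiftPerm]))).fst_lt
    (by simp [hF.1, shiftPerm])

theorem commute_shiftPerm (hF : IsLiftPerm x₀ f F) : Commute F (shiftPerm X) := by
  refine Equiv.ext fun p => ?_
  have hsnd : (F (shiftPerm X p)).2 = (shiftPerm X (F p)).2 := by simp [hF.1, shiftPerm]
  refine Prod.ext (le_antisymm ?_ (hF.fst_add_one_le p)) hsnd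
  by_contra! hlt
  have h₁ := hF.inv.2 _ _ (Or.inl hlt)
  have h₂ := hF.inv.fst_add_one_le (F p)
  have h₃ := h₁.fst_lt (by rw [hF.inv.1, hF.inv.1]; exact congrArg _ hsnd.symm)
  simp [shiftPerm] at h₂ h₃
  omega

theorem eq_zpow_of_one (hF : IsLiftPerm x₀ 1 F) : ∃ k : ℤ, F = shiftPerm X ^ k := by
  have hc : ∀ (n : ℤ) (x : X), (F (n, x)).1 = n + (F (0, x)).1 := fun n x => by
    have h := congrArg (fun G : Equiv.Perm (ℤ × X) => (G (0, x)).1)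
      (hF.commute_shiftPerm.zpow_right n).eq
    simp only [Equiv.Perm.mul_apply, shiftPerm_zpow_apply, zero_add] at h
    rw [h, add_comm]
  have hle : ∀ x y : X, Prec x₀ x y → (F (0, x)).1 = (F (0, y)).1 := fun x y h => by
    have h₁ := (hF.2 (0, x) (0, y) (Or.inr ⟨rfl, h⟩)).fst_le
    have h₂ := hF.2 (0, y) (1, x) (Or.inl one_pos)
    rcases h₂ with h₂ | ⟨-, h₂⟩
    · rw [hc 1 x] at h₂
      omega
    · simp only [hF.1] at h₂
      exact absurd h h₂.asymm
  refine ⟨(F (0, x₀)).1, Equiv.ext fun p => ?_⟩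
  rw [shiftPerm_zpow_apply]
  refine Prod.ext ?_ (hF.1 p)
  rw [← Prod.mk.eta (p := p), hc]
  rcases Prec.trichotomous x₀ p.2 x₀ with h | h | h
  · simp [hle _ _ h]
  · simp [h]
  · simp [hle _ _ h]

theorem eq_zpow_mul (hF : IsLiftPerm x₀ f F) (hF' : IsLiftPerm x₀ f F') :
    ∃ k : ℤ, F' = shiftPerm X ^ k * F := by
  have h := hF'.mul hF.inv
  rw [mul_inv_cancel] at h
  obtain ⟨k, hk⟩ := h.eq_zpow_of_one
  exact ⟨k, by rw [← hk, inv_mul_cancel_right]⟩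

theorem commutator_eq {A B : Equiv.Perm X} {F F' G G' : Equiv.Perm (ℤ × X)}
    (hF : IsLiftPerm x₀ A F) (hF' : IsLiftPerm x₀ A F')
    (hG : IsLiftPerm x₀ B G) (hG' : IsLiftPerm x₀ B G') :
    F' * G' * F'⁻¹ * G'⁻¹ = F * G * F⁻¹ * G⁻¹ := by
  obtain ⟨k, rfl⟩ := hF.eq_zpow_mul hF'
  obtain ⟨l, rfl⟩ := hG.eq_zpow_mul hG'
  have hkF : Commute (shiftPerm X ^ k) F := (hF.commute_shiftPerm.zpow_right k).symm
  have hkG : Commute (shiftPerm X ^ k) G := (hG.commute_shiftPerm.zpow_right k).symm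
  have hlF : Commute (shiftPerm X ^ l) F := (hF.commute_shiftPerm.zpow_right l).symm
  have hlG : Commute (shiftPerm X ^ l) G := (hG.commute_shiftPerm.zpow_right l).symm
  have hkl : Commute (shiftPerm X ^ k) (shiftPerm X ^ l) := Commute.zpow_zpow_self _ k l
  generalize shiftPerm X ^ k = s at *
  generalize shiftPerm X ^ l = t at *
  calc s * F * (t * G) * (s * F)⁻¹ * (t * G)⁻¹
      = (s * F * (t * G)) * ((t * G) * (s * F))⁻¹ := by group
    _ = (s * t * (F * G)) * (s * t * (G * F))⁻¹ := by
      rw [hlF.symm.mul_mul_mul_comm, hkG.symm.mul_mul_mul_comm, hkl.eq]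
    _ = s * t * (F * G * F⁻¹ * G⁻¹) * (s * t)⁻¹ := by group
    _ = F * G * F⁻¹ * G⁻¹ := by
      have h : Commute (s * t) (F * G * F⁻¹ * G⁻¹) :=
        (((hkF.mul_left hlF).mul_right (hkG.mul_left hlG)).mul_right
          (hkF.mul_left hlF).inv_right).mul_right (hkG.mul_left hlG).inv_right
      rw [h.eq, mul_inv_cancel_right]

theorem exists_of_orderPreserving (x₀ : X) (hf : OrderPreservingPerm f) :
    ∃ F, IsLiftPerm x₀ f F := by
  refine ⟨rebasePerm (f x₀) x₀ * Equiv.prodCongr (Equiv.refl ℤ) f,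
    fun p => by simp [rebasePerm], fun a b h => rebasePerm_lt _ _ _ _ ?_⟩
  rcases h with h | ⟨h, h'⟩
  exacts [Or.inl h, Or.inr ⟨h, h'.map hf⟩]

theorem rebase (x₀ : X) (hF : IsLiftPerm y₀ f F) :
    IsLiftPerm x₀ f (rebasePerm y₀ x₀ * F * (rebasePerm y₀ x₀)⁻¹) := by
  refine ⟨fun p => ?_, fun a b h => rebasePerm_lt _ _ _ _ (hF.2 _ _ ?_)⟩
  · simp only [Equiv.Perm.mul_apply]
    exact hF.1 _
  · exact LtZX.of_map (rebasePerm_lt y₀ x₀) (by simpa using h)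

end IsLiftPerm

/-- Well-definedness of the Euler number via Milnor's algorithm (Section 2.3.4 of the
paper): if `A₁, B₁, …, A_g, B_g` are order-preserving bijections of `X` satisfying the
surface relation, then for any base point and any choice of lifts, the product of the
commutators of the lifts is `hᵉ` for one and the same integer `e`. -/
theorem euler_number_well_defined {X : Type*} [CircularOrder X] (x₀ : X)
    (g : ℕ) (hg : 1 ≤ g) (A B : Fin g → Equiv.Perm X)
    (hA : ∀ i, OrderPreservingPerm (A i)) (hB : ∀ i, OrderPreservingPerm (B i))
    (hrel : (List.ofFn fun i => A i * B i * (A i)⁻¹ * (B i)⁻¹).prod = 1) :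
    ∃! e : ℤ, ∀ (y₀ : X) (At Bt : Fin g → Equiv.Perm (ℤ × X)),
      (∀ i, IsLiftPerm y₀ (A i) (At i)) → (∀ i, IsLiftPerm y₀ (B i) (Bt i)) →
      (List.ofFn fun i => At i * Bt i * (At i)⁻¹ * (Bt i)⁻¹).prod = shiftPerm X ^ e := by
  choose At₀ hAt₀ using fun i => IsLiftPerm.exists_of_orderPreserving x₀ (hA i)
  choose Bt₀ hBt₀ using fun i => IsLiftPerm.exists_of_orderPreserving x₀ (hB i)
  have hprod := IsLiftPerm.list_prod
    fun i => (((hAt₀ i).mul (hBt₀ i)).mul (hAt₀ i).inv).mul (hBt₀ i).inv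
  rw [hrel] at hprod
  obtain ⟨e, he⟩ := hprod.eq_zpow_of_one
  refine ⟨e, fun y₀ At Bt hAt hBt => ?_, fun e' he' => ?_⟩
  · have hconj : (List.ofFn fun i => At₀ i * Bt₀ i * (At₀ i)⁻¹ * (Bt₀ i)⁻¹).prod =
        MulAut.conj (rebasePerm y₀ x₀)
          (List.ofFn fun i => At i * Bt i * (At i)⁻¹ * (Bt i)⁻¹).prod := by
      rw [map_list_prod, List.map_ofFn]
      congr 2
      funext i
      rw [← (hAt₀ i).commutator_eq ((hAt i).rebase x₀) (hBt₀ i) ((hBt i).rebase x₀)]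
      simp only [Function.comp_apply, map_mul, map_inv, MulAut.conj_apply]
    rw [he] at hconj
    apply (MulAut.conj (rebasePerm y₀ x₀)).injective
    rw [← hconj, MulAut.conj_apply,
      ((rebasePerm_commute_shiftPerm y₀ x₀).zpow_right e).eq, mul_inv_cancel_right]
  · have h := (he' x₀ At₀ Bt₀ hAt₀ hBt₀).symm.trans he
    have h' := congrArg (fun G : Equiv.Perm (ℤ × X) => (G (0, x₀)).1) h
    simpa only [shiftPerm_zpow_apply, zero_add] using h'
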